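/- For the elephant random walk remembering only the most recent step, started at X_1 = 1: (i) E(X_{n+1}) = (2p−1)^n for every n ≥ 0, and E(T_{n+1}) = (1 − (2p−1)^{n+1})/(2(1−p)) for every n ≥ 0; (ii) E(T_n·X_n) = (1 − (2p−1)^n)/(2(1−p)) for every n ≥ 1; (iii) Var(T_{n+1}) = np/(1−p) + O(1) as n → ∞, i.e. Var(T_n) − np/(1−p) stays bounded. -/

import Mathlib

open MeasureTheory ProbabilityTheory Filter Topology

noncomputable section

/-- The σ-algebra generated by the steps `X 1, …, X n`. -/
def sigmaUpTo {Ω : Type*} (X : ℕ → Ω → ℝ) (n : ℕ) : MeasurableSpace Ω :=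
  ⨆ i ∈ Finset.Icc 1 n, MeasurableSpace.comap (X i) inferInstance

/-- The σ-algebra generated by all the steps `X 1, X 2, …`. -/
def sigmaAll {Ω : Type*} (X : ℕ → Ω → ℝ) : MeasurableSpace Ω :=
  ⨆ i ∈ Set.Ici 1, MeasurableSpace.comap (X i) inferInstance

/-- The partial sum `X 1 + ⋯ + X n` of the walk. -/
def partialSum {Ω : Type*} (X : ℕ → Ω → ℝ) (n : ℕ) (ω : Ω) : ℝ :=
  ∑ k ∈ Finset.Icc 1 n, X k ω

/-- Convergence in distribution of the random variables `f n` to the law `ν`,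
expressed as weak convergence tested against bounded continuous functions. -/
def TendstoInDistribution {Ω : Type*} [MeasurableSpace Ω] (μ : Measure Ω)
    (f : ℕ → Ω → ℝ) (ν : Measure ℝ) : Prop :=
  ∀ g : BoundedContinuousFunction ℝ ℝ,
    Tendsto (fun n => ∫ ω, g (f n ω) ∂μ) atTop (𝓝 (∫ x, g x ∂ν))

lemma sigmaUpTo_le {Ω : Type*} [mΩ : MeasurableSpace Ω] {X : ℕ → Ω → ℝ}
    (hX : ∀ i, Measurable (X i)) (n : ℕ) : sigmaUpTo X n ≤ mΩ :=
  iSup₂_le fun i _ => (hX i).comap_le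

lemma measurable_partialSum {Ω : Type*} (X : ℕ → Ω → ℝ) (n : ℕ) :
    Measurable[sigmaUpTo X n] (partialSum X n) := by
  refine Finset.measurable_fun_sum _ fun i hi => ?_
  exact (comap_measurable (X i)).mono
    (le_iSup₂ (f := fun i (_ : i ∈ Finset.Icc 1 n) =>
      MeasurableSpace.comap (X i) inferInstance) i hi) le_rfl

lemma partialSum_succ {Ω : Type*} (X : ℕ → Ω → ℝ) (n : ℕ) (ω : Ω) :
    partialSum X (n + 1) ω = partialSum X n ω + X (n + 1) ω :=
  Finset.sum_Icc_succ_top (by omega) _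

/-- The tower property: an `m`-measurable factor can be kept while its partner is replaced by
a version of the conditional expectation. -/
lemma integral_mul_eq_of_condExp_ae_eq {Ω : Type*} {m mΩ : MeasurableSpace Ω} {μ : Measure Ω}
    [IsFiniteMeasure μ] (hm : m ≤ mΩ) {f g h : Ω → ℝ} (hf : Measurable[m] f)
    (hfg : Integrable (f * g) μ) (hg : Integrable g μ) (hgh : μ[g | m] =ᵐ[μ] h) :
    ∫ ω, f ω * g ω ∂μ = ∫ ω, f ω * h ω ∂μ := by
  have hpull := condExp_mul_of_stronglyMeasurable_left hf.stronglyMeasurable hfg hg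
  calc ∫ ω, f ω * g ω ∂μ = ∫ ω, (μ[f * g | m]) ω ∂μ := (integral_condExp hm).symm
    _ = ∫ ω, f ω * h ω ∂μ := by
      refine integral_congr_ae ?_
      filter_upwards [hpull, hgh] with ω h₁ h₂
      rw [h₁, Pi.mul_apply, h₂]

/-- The solution of the second moment recursion, with its mean square subtracted, stays within
a bounded distance of its linear part. -/
lemma abs_second_moment_remainder_le {a : ℝ} (ha : |a| ≤ 1) (n : ℕ) :
    |1 - 2 * a ^ 2 * (1 - a ^ n) / (1 - a) ^ 2 - ((1 - a ^ (n + 1)) / (1 - a)) ^ 2|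
      ≤ 1 + 8 / (1 - a) ^ 2 := by
  have hpow (k : ℕ) : |a ^ k| ≤ 1 := by
    rw [abs_pow]; exact pow_le_one₀ (abs_nonneg a) ha
  obtain ⟨h₁, h₂⟩ := abs_le.mp (hpow n)
  obtain ⟨h₃, h₄⟩ := abs_le.mp (hpow (n + 1))
  have h₅ : a ^ 2 ≤ 1 := (abs_le.mp (hpow 2)).2
  have hrw : 1 - 2 * a ^ 2 * (1 - a ^ n) / (1 - a) ^ 2 - ((1 - a ^ (n + 1)) / (1 - a)) ^ 2
      = 1 - (2 * a ^ 2 * (1 - a ^ n) + (1 - a ^ (n + 1)) ^ 2) / (1 - a) ^ 2 := by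
    rw [div_pow]; ring
  have hnonneg : 0 ≤ 2 * a ^ 2 * (1 - a ^ n) + (1 - a ^ (n + 1)) ^ 2 := by
    have := mul_nonneg (sq_nonneg a) (sub_nonneg.mpr h₂)
    nlinarith [sq_nonneg (1 - a ^ (n + 1))]
  have hle : 2 * a ^ 2 * (1 - a ^ n) + (1 - a ^ (n + 1)) ^ 2 ≤ 8 := by
    have h₆ : a ^ 2 * (1 - a ^ n) ≤ 1 * 2 :=
      mul_le_mul h₅ (by linarith) (by linarith) zero_le_one
    nlinarith
  have hq := div_le_div_of_nonneg_right hle (sq_nonneg (1 - a))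
  have hq₀ := div_nonneg hnonneg (sq_nonneg (1 - a))
  rw [hrw, abs_le]
  constructor <;> linarith

/-- for the elephant random walk remembering only the most recent step,
started at `X₁ = 1`: (i) `E(X_{n+1}) = (2p-1)ⁿ` and
`E(T_{n+1}) = (1 - (2p-1)^{n+1})/(2(1-p))` for every `n ≥ 0`;
(ii) `E(Tₙ·Xₙ) = (1 - (2p-1)ⁿ)/(2(1-p))` for every `n ≥ 1`;
(iii) `Var(T_{n+1}) = np/(1-p) + O(1)`, i.e. the difference stays bounded. -/
theorem elephant_last_step_moment_formulas
    {Ω : Type*} [MeasurableSpace Ω] (μ : Measure Ω) [IsProbabilityMeasure μ]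
    (p : ℝ) (hp0 : 0 < p) (hp1 : p < 1)
    (X : ℕ → Ω → ℝ)
    (hXmeas : ∀ i, Measurable (X i))
    (hval : ∀ i, 1 ≤ i → ∀ᵐ ω ∂μ, X i ω = 1 ∨ X i ω = -1)
    (hinit : ∀ᵐ ω ∂μ, X 1 ω = 1)
    (hcond : ∀ n, 1 ≤ n →
      μ[X (n+1) | sigmaUpTo X n] =ᵐ[μ] fun ω => (2*p-1) * X n ω) :
    (∀ n : ℕ, ∫ ω, X (n+1) ω ∂μ = (2*p-1)^n) ∧
    (∀ n : ℕ, ∫ ω, partialSum X (n+1) ω ∂μ = (1 - (2*p-1)^(n+1)) / (2*(1-p))) ∧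
    (∀ n : ℕ, 1 ≤ n → ∫ ω, partialSum X n ω * X n ω ∂μ = (1 - (2*p-1)^n) / (2*(1-p))) ∧
    (∃ C : ℝ, ∀ n : ℕ,
      |variance (partialSum X (n+1)) μ - n*p/(1-p)| ≤ C) := by
  have hLp (i : ℕ) (hi : 1 ≤ i) : MemLp (X i) 2 μ := by
    refine MemLp.of_bound (hXmeas i).aestronglyMeasurable 1 ?_
    filter_upwards [hval i hi] with ω hω
    rcases hω with h | h <;> simp [h]
  have hint (i : ℕ) (hi : 1 ≤ i) : Integrable (X i) μ := (hLp i hi).integrable one_le_two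
  have hTLp (n : ℕ) : MemLp (partialSum X n) 2 μ :=
    memLp_finsetSum _ fun i hi => hLp i (Finset.mem_Icc.mp hi).1
  have hTint (n : ℕ) : Integrable (partialSum X n) μ := (hTLp n).integrable one_le_two
  have hTX (n i : ℕ) (hi : 1 ≤ i) : Integrable (fun ω => partialSum X n ω * X i ω) μ :=
    (hTLp n).integrable_mul (hLp i hi)
  have hsq (i : ℕ) (hi : 1 ≤ i) : ∀ᵐ ω ∂μ, X i ω * X i ω = 1 := by
    filter_upwards [hval i hi] with ω hω
    rcases hω with h | h <;> simp [h]
  have hT1 (ω : Ω) : partialSum X 1 ω = X 1 ω := by simp [partialSum]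
  have ha : |2 * p - 1| ≤ 1 := abs_le.mpr ⟨by linarith, by linarith⟩
  have hden : 2 * (1 - p) = 1 - (2 * p - 1) := by ring
  have hlin : p / (1 - p) = 1 + 2 * (2 * p - 1) / (1 - (2 * p - 1)) := by
    have : 1 - p ≠ 0 := by linarith
    rw [← hden]; field_simp; ring
  have ha1 : 1 - (2 * p - 1) ≠ 0 := by linarith
  simp only [mul_div_assoc, hlin, hden]
  generalize 2 * p - 1 = a at *
  have hstep (n : ℕ) (hn : 1 ≤ n) : ∫ ω, partialSum X n ω * X (n + 1) ω ∂μ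
      = a * ∫ ω, partialSum X n ω * X n ω ∂μ := by
    rw [integral_mul_eq_of_condExp_ae_eq (sigmaUpTo_le hXmeas n) (measurable_partialSum X n)
      (hTX n (n + 1) (by omega)) (hint (n + 1) (by omega)) (hcond n hn), ← integral_const_mul]
    simp only [mul_left_comm]
  have hmean (n : ℕ) : ∫ ω, X (n + 1) ω ∂μ = a ^ n := by
    induction n with
    | zero => simp [integral_congr_ae hinit]
    | succ n ih =>
      rw [← integral_condExp (sigmaUpTo_le hXmeas (n + 1)),
        integral_congr_ae (hcond (n + 1) (by omega)), integral_const_mul, ih, pow_succ']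
  have hTmean (n : ℕ) : ∫ ω, partialSum X (n + 1) ω ∂μ = (1 - a ^ (n + 1)) / (1 - a) := by
    induction n with
    | zero => simp only [zero_add, hT1, hmean 0, pow_zero, pow_one, div_self ha1]
    | succ n ih =>
      simp only [partialSum_succ X (n + 1)]
      rw [integral_add (hTint _) (hint _ (by omega)), ih, hmean]
      field_simp
      ring
  have hcross (n : ℕ) (hn : 1 ≤ n) :
      ∫ ω, partialSum X n ω * X n ω ∂μ = (1 - a ^ n) / (1 - a) := by
    induction n, hn using Nat.le_induction with
    | base =>
      simp only [hT1, integral_congr_ae (hsq 1 le_rfl)]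
      simp [div_self ha1]
    | succ n hn ih =>
      simp only [partialSum_succ X n, add_mul]
      have hXX : Integrable (fun ω => X (n + 1) ω * X (n + 1) ω) μ :=
        (hLp _ (by omega)).integrable_mul (hLp _ (by omega))
      rw [integral_add (hTX _ _ (by omega)) hXX,
        hstep n hn, ih, integral_congr_ae (hsq (n + 1) (by omega))]
      simp only [integral_const, probReal_univ, one_smul]
      field_simp
      ring
  have hsecond (n : ℕ) : ∫ ω, partialSum X (n + 1) ω ^ 2 ∂μ
      = 1 + n * (1 + 2 * (a / (1 - a))) - 2 * a ^ 2 * (1 - a ^ n) / (1 - a) ^ 2 := by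
    induction n with
    | zero =>
      simp only [zero_add, hT1, sq, integral_congr_ae (hsq 1 le_rfl)]
      simp
    | succ n ih =>
      have hexp : (fun ω => partialSum X (n + 1 + 1) ω ^ 2) =ᵐ[μ] fun ω =>
          partialSum X (n + 1) ω ^ 2 + 2 * (partialSum X (n + 1) ω * X (n + 1 + 1) ω) + 1 := by
        filter_upwards [hsq (n + 1 + 1) (by omega)] with ω hω
        rw [partialSum_succ]
        linear_combination hω
      have hcr := (hTX (n + 1) (n + 1 + 1) (by omega)).const_mul 2
      have hadd : Integrable (fun ω => partialSum X (n + 1) ω ^ 2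
          + 2 * (partialSum X (n + 1) ω * X (n + 1 + 1) ω)) μ := (hTLp _).integrable_sq.add hcr
      rw [integral_congr_ae hexp,
        integral_add hadd (integrable_const _), integral_add (hTLp _).integrable_sq hcr,
        integral_const_mul, hstep _ (by omega),
        hcross _ (by omega), ih]
      simp only [integral_const, probReal_univ, one_smul]
      push_cast
      field_simp
      ring
  refine ⟨hmean, hTmean, hcross, 1 + 8 / (1 - a) ^ 2, fun n => ?_⟩
  rw [variance_eq_sub (hTLp _), hTmean]
  simp only [Pi.pow_apply, hsecond]
  convert abs_second_moment_remainder_le ha n using 2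
  ring
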